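/- Let M ≥ 3 and α, β, γ ∈ ℝ, and suppose the three numbers λ₁ = α + 2(M−2)β + ((M−2)(M−3)/2)γ, λ₂ = α + (M−4)β − (M−3)γ, λ₃ = α − 2β + γ are all nonzero. Then the matrix Δ(M,α,β,γ) = (α−γ)I + (β−γ)J + γU is invertible, and its inverse is again of the same form: there exist real numbers α', β', γ' such that Δ(M,α,β,γ)⁻¹ = Δ(M,α',β',γ'), and these parameters satisfy λᵢ(M,α',β',γ') = 1/λᵢ(M,α,β,γ) for i = 1, 2, 3, where λᵢ(M,α',β',γ') denotes the same three eigenvalue expressions evaluated at (α',β',γ'). -/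

import Mathlib

/-- Index set: ordered pairs `(i,j)` with `1 ≤ i < j ≤ M`. -/
abbrev PairIdx (M : ℕ) := {ij : Fin M × Fin M // ij.1 < ij.2}

/-- Adjacency matrix of the Johnson graph `J(M,2)`. -/
noncomputable def johnsonJ (M : ℕ) : Matrix (PairIdx M) (PairIdx M) ℝ :=
  Matrix.of fun a b =>
    if (({a.1.1, a.1.2} : Finset (Fin M)) ∩ {b.1.1, b.1.2}).card = 1 then 1 else 0

/-- The all-ones matrix `U`. -/
noncomputable def allOnes (M : ℕ) : Matrix (PairIdx M) (PairIdx M) ℝ :=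
  Matrix.of fun _ _ => 1

/-- The matrix `Δ(M,α,β,γ) = (α-γ) I + (β-γ) J + γ U`. -/
noncomputable def deltaMat (M : ℕ) (α β γ : ℝ) : Matrix (PairIdx M) (PairIdx M) ℝ :=
  (α - γ) • (1 : Matrix (PairIdx M) (PairIdx M) ℝ) + (β - γ) • johnsonJ M + γ • allOnes M

/-- The eigenvalue expressions `λ₁, λ₂, λ₃` of `Δ(M,α,β,γ)`. -/
noncomputable def lam1 (M : ℕ) (α β γ : ℝ) : ℝ :=
  α + 2 * ((M : ℝ) - 2) * β + ((M : ℝ) - 2) * ((M : ℝ) - 3) / 2 * γ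

noncomputable def lam2 (M : ℕ) (α β γ : ℝ) : ℝ :=
  α + ((M : ℝ) - 4) * β - ((M : ℝ) - 3) * γ

noncomputable def lam3 (M : ℕ) (α β γ : ℝ) : ℝ := α - 2 * β + γ

/-- The incidence matrix of pairs against points. -/
noncomputable def pairIncidence (M : ℕ) : Matrix (PairIdx M) (Fin M) ℝ :=
  Matrix.of fun p i => (if p.1.1 = i then 1 else 0) + (if p.1.2 = i then 1 else 0)

/-- The all-ones matrix on points. -/
noncomputable def pointOnes (M : ℕ) : Matrix (Fin M) (Fin M) ℝ :=
  Matrix.of fun _ _ => 1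

open scoped Matrix

lemma pairIncidence_mul_transpose (M : ℕ) :
    pairIncidence M * (pairIncidence M)ᵀ = (2 : ℝ) • 1 + johnsonJ M := by
  ext ⟨⟨a, b⟩, hab⟩ ⟨⟨c, d⟩, hcd⟩
  simp only at hab hcd
  have hba := hab.ne'
  have hdc := hcd.ne'
  simp only [Matrix.mul_apply, pairIncidence, Matrix.transpose_apply, Matrix.of_apply, johnsonJ,
    Matrix.add_apply, Matrix.smul_apply, Matrix.one_apply, Subtype.mk.injEq, Prod.mk.injEq,
    add_mul, mul_add, Finset.sum_add_distrib, ite_mul, one_mul, zero_mul, Finset.sum_ite_eq,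
    Finset.mem_univ, if_true, smul_eq_mul]
  by_cases h1 : a = c
  · subst h1
    by_cases h2 : b = d
    · subst h2
      simp [Finset.card_pair hab.ne, hab.ne, hba]
      norm_num
    · have h : (({a, b} : Finset (Fin M)) ∩ {a, d}) = {a} := by
        ext x; simp only [Finset.mem_inter, Finset.mem_insert, Finset.mem_singleton]; grind
      simp [h, h2, Ne.symm h2, hab.ne, hdc]
  · by_cases h2 : b = d
    · subst h2
      have h : (({a, b} : Finset (Fin M)) ∩ {c, b}) = {b} := by
        ext x; simp only [Finset.mem_inter, Finset.mem_insert, Finset.mem_singleton]; grind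
      simp [h, h1, Ne.symm h1, hba, hcd.ne]
    · by_cases h3 : a = d
      · subst h3
        have h : (({a, b} : Finset (Fin M)) ∩ {c, a}) = {a} := by
          ext x; simp only [Finset.mem_inter, Finset.mem_insert, Finset.mem_singleton]; grind
        have h4 : c ≠ b := (hcd.trans hab).ne
        simp [h, h1, Ne.symm h1, h2, Ne.symm h2, h4]
      · by_cases h4 : b = c
        · subst h4
          have h : (({a, b} : Finset (Fin M)) ∩ {b, d}) = {b} := by
            ext x; simp only [Finset.mem_inter, Finset.mem_insert, Finset.mem_singleton]; grind
          simp [h, h1, h2, Ne.symm h1, Ne.symm h2, Ne.symm h3]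
        · have h : (({a, b} : Finset (Fin M)) ∩ {c, d}) = ∅ := by
            ext x; simp only [Finset.mem_inter, Finset.mem_insert, Finset.mem_singleton]; grind
          simp [h, h1, h2, Ne.symm h1, Ne.symm h2, Ne.symm h3, Ne.symm h4]

lemma sum_pairIdx (M : ℕ) (f : Fin M → Fin M → ℝ) :
    ∑ p : PairIdx M, f p.1.1 p.1.2 = ∑ a, ∑ b, if a < b then f a b else 0 := by
  rw [← Fintype.sum_prod_type' (f := fun a b => if a < b then f a b else 0),
    ← Finset.sum_filter]
  exact (Finset.sum_subtype _ (by simp) fun p : Fin M × Fin M => f p.1 p.2).symm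

lemma sum_ite_lt_add_sum_ite_gt (M : ℕ) (i : Fin M) :
    (∑ b, if i < b then (1 : ℝ) else 0) + (∑ b, if b < i then (1 : ℝ) else 0) = M - 1 := by
  have h (b : Fin M) : (if i < b then (1 : ℝ) else 0) + (if b < i then 1 else 0) =
      1 - if b = i then 1 else 0 := by
    rcases lt_trichotomy i b with hb | hb | hb
    · simp [hb, hb.not_gt, hb.ne']
    · simp [hb]
    · simp [hb, hb.not_gt, hb.ne]
  rw [← Finset.sum_add_distrib, Finset.sum_congr rfl fun b _ => h b, Finset.sum_sub_distrib]
  simp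

lemma transpose_mul_pairIncidence (M : ℕ) :
    (pairIncidence M)ᵀ * pairIncidence M = ((M : ℝ) - 2) • 1 + pointOnes M := by
  ext i j
  simp only [Matrix.mul_apply, pairIncidence, Matrix.transpose_apply, Matrix.of_apply, pointOnes,
    Matrix.add_apply, Matrix.smul_apply, Matrix.one_apply, smul_eq_mul]
  rw [sum_pairIdx M fun a b => ((if a = i then 1 else 0) + (if b = i then 1 else 0)) *
    ((if a = j then 1 else 0) + (if b = j then 1 else 0))]
  have key (a b : Fin M) : (if a < b then (((if a = i then 1 else 0) + (if b = i then 1 else 0)) *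
      ((if a = j then 1 else 0) + (if b = j then 1 else 0)) : ℝ) else 0) =
      (if a = i then (if i = j then (if i < b then 1 else 0) else 0) else 0)
      + (if a = i then (if b = j then (if i < j then 1 else 0) else 0) else 0)
      + (if a = j then (if b = i then (if j < i then 1 else 0) else 0) else 0)
      + (if b = i then (if i = j then (if a < i then 1 else 0) else 0) else 0) := by
    split_ifs <;> grind
  simp only [key, Finset.sum_add_distrib]
  have h (i : Fin M) := sum_ite_lt_add_sum_ite_gt M i
  rcases lt_trichotomy i j with hb | hb | hb
  · simp [hb, hb.not_gt, hb.ne]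
  · subst hb
    simp only [Finset.sum_boole] at h
    have := h i
    simp at this ⊢
    linarith
  · simp [hb, hb.not_gt, hb.ne']

lemma pointOnes_mul_self (M : ℕ) : pointOnes M * pointOnes M = (M : ℝ) • pointOnes M := by
  ext i j
  simp [pointOnes, Matrix.mul_apply]

lemma pairIncidence_mul_pointOnes_mul_transpose (M : ℕ) :
    pairIncidence M * pointOnes M * (pairIncidence M)ᵀ = (4 : ℝ) • allOnes M := by
  ext p q
  simp [pointOnes, allOnes, pairIncidence, Matrix.mul_apply, Finset.sum_add_distrib, mul_add]
  norm_num

lemma johnsonJ_mul_self (M : ℕ) :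
    johnsonJ M * johnsonJ M =
      (2 * (M : ℝ) - 8) • 1 + ((M : ℝ) - 6) • johnsonJ M + (4 : ℝ) • allOnes M := by
  have h : (pairIncidence M * (pairIncidence M)ᵀ) * (pairIncidence M * (pairIncidence M)ᵀ) =
      ((M : ℝ) - 2) • (pairIncidence M * (pairIncidence M)ᵀ) + (4 : ℝ) • allOnes M := by
    rw [← pairIncidence_mul_pointOnes_mul_transpose, Matrix.mul_assoc,
      ← Matrix.mul_assoc (pairIncidence M)ᵀ, transpose_mul_pairIncidence]
    simp [Matrix.mul_add, Matrix.add_mul, Matrix.mul_assoc]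
  rw [pairIncidence_mul_transpose] at h
  simp only [add_mul, mul_add, smul_mul_assoc, mul_smul_comm, one_mul, mul_one] at h
  linear_combination (norm := module) h

lemma johnsonJ_mul_allOnes (M : ℕ) :
    johnsonJ M * allOnes M = (2 * ((M : ℝ) - 2)) • allOnes M := by
  have h : (pairIncidence M * (pairIncidence M)ᵀ) * ((4 : ℝ) • allOnes M) =
      (2 * (M : ℝ) - 2) • ((4 : ℝ) • allOnes M) := by
    rw [← pairIncidence_mul_pointOnes_mul_transpose]
    have : pairIncidence M * (pairIncidence M)ᵀ *
        (pairIncidence M * pointOnes M * (pairIncidence M)ᵀ) =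
        pairIncidence M * (((pairIncidence M)ᵀ * pairIncidence M) * pointOnes M) *
          (pairIncidence M)ᵀ := by simp only [Matrix.mul_assoc]
    rw [this, transpose_mul_pairIncidence, add_mul, pointOnes_mul_self, smul_mul_assoc, one_mul,
      ← add_smul, Matrix.mul_smul, Matrix.smul_mul]
    congr 1; ring
  rw [pairIncidence_mul_transpose] at h
  simp only [add_mul, mul_smul_comm, smul_mul_assoc, one_mul] at h
  linear_combination (norm := module) (1 / 4 : ℝ) • h

lemma allOnes_transpose (M : ℕ) : (allOnes M)ᵀ = allOnes M := rfl

lemma johnsonJ_transpose (M : ℕ) : (johnsonJ M)ᵀ = johnsonJ M := by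
  ext p q
  simp [johnsonJ, Finset.inter_comm]

lemma allOnes_mul_johnsonJ (M : ℕ) :
    allOnes M * johnsonJ M = (2 * ((M : ℝ) - 2)) • allOnes M := by
  simpa [Matrix.transpose_mul, allOnes_transpose, johnsonJ_transpose] using
    congrArg Matrix.transpose (johnsonJ_mul_allOnes M)

lemma allOnes_mul_self (M : ℕ) :
    allOnes M * allOnes M = ((M : ℝ) * (M - 1) / 2) • allOnes M := by
  have hc : ∑ p : PairIdx M, (1 : ℝ) = (M : ℝ) * (M - 1) / 2 := by
    have h : ∑ i : Fin M, (∑ b, if i < b then (1 : ℝ) else 0) +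
        ∑ i : Fin M, (∑ b, if b < i then (1 : ℝ) else 0)
        = ∑ _i : Fin M, ((M : ℝ) - 1) := by
      rw [← Finset.sum_add_distrib]
      exact Finset.sum_congr rfl fun i _ => sum_ite_lt_add_sum_ite_gt M i
    have hsymm : ∑ i : Fin M, (∑ b, if b < i then (1 : ℝ) else 0) =
        ∑ i : Fin M, ∑ b, if i < b then (1 : ℝ) else 0 := Finset.sum_comm
    rw [hsymm] at h
    rw [sum_pairIdx M fun _ _ => 1]
    rw [Finset.sum_const, Finset.card_univ, Fintype.card_fin, nsmul_eq_mul] at h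
    linarith
  ext p q
  simp only [allOnes, Matrix.mul_apply, Matrix.of_apply, Matrix.smul_apply, mul_one, hc,
    smul_eq_mul]

lemma deltaMat_mul (M : ℕ) (α β γ α' β' γ' : ℝ) :
    deltaMat M α β γ * deltaMat M α' β' γ' =
      ((α - γ) * (α' - γ') + (2 * M - 8) * ((β - γ) * (β' - γ'))) • 1 +
      ((α - γ) * (β' - γ') + (β - γ) * (α' - γ') + (M - 6) * ((β - γ) * (β' - γ'))) • johnsonJ M +
      (4 * ((β - γ) * (β' - γ')) + (α - γ) * γ' + γ * (α' - γ') +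
        2 * (M - 2) * ((β - γ) * γ' + γ * (β' - γ')) + M * (M - 1) / 2 * (γ * γ')) •
        allOnes M := by
  simp only [deltaMat, add_mul, mul_add, smul_mul_assoc, mul_smul_comm, one_mul, mul_one,
    johnsonJ_mul_self, johnsonJ_mul_allOnes, allOnes_mul_johnsonJ, allOnes_mul_self]
  module

lemma deltaMat_mul_eq_one {M : ℕ} (hM : 3 ≤ M) {α β γ α' β' γ' : ℝ}
    (h1 : lam1 M α β γ * lam1 M α' β' γ' = 1) (h2 : lam2 M α β γ * lam2 M α' β' γ' = 1)
    (h3 : lam3 M α β γ * lam3 M α' β' γ' = 1) :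
    deltaMat M α β γ * deltaMat M α' β' γ' = 1 := by
  have hM' : (3 : ℝ) ≤ M := by exact_mod_cast hM
  unfold lam1 at h1
  unfold lam2 at h2
  unfold lam3 at h3
  have hJ : (α - γ) * (β' - γ') + (β - γ) * (α' - γ') + (M - 6) * ((β - γ) * (β' - γ')) = 0 := by
    have hne : (M : ℝ) - 2 ≠ 0 := by linarith
    apply mul_left_cancel₀ hne
    linear_combination h2 - h3
  have hI : (α - γ) * (α' - γ') + (2 * M - 8) * ((β - γ) * (β' - γ')) = 1 := by
    linear_combination h3 + 2 * hJ
  have hU : 4 * ((β - γ) * (β' - γ')) + (α - γ) * γ' + γ * (α' - γ') +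
      2 * (M - 2) * ((β - γ) * γ' + γ * (β' - γ')) + M * (M - 1) / 2 * (γ * γ') = 0 := by
    have hne : (M : ℝ) * (M - 1) / 2 ≠ 0 := by
      have : 0 < (M : ℝ) * (M - 1) := mul_pos (by linarith) (by linarith)
      positivity
    apply mul_left_cancel₀ hne
    linear_combination h1 - hI - 2 * (M - 2) * hJ
  rw [deltaMat_mul, hI, hJ, hU]
  simp

lemma exists_lam_eq {M : ℕ} (hM : 3 ≤ M) (l₁ l₂ l₃ : ℝ) :
    ∃ α β γ : ℝ, lam1 M α β γ = l₁ ∧ lam2 M α β γ = l₂ ∧ lam3 M α β γ = l₃ := by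
  have hM' : (3 : ℝ) ≤ M := by exact_mod_cast hM
  have h0 : (M : ℝ) ≠ 0 := by linarith
  have h1 : (M : ℝ) - 1 ≠ 0 := by linarith
  have h2 : (M : ℝ) - 2 ≠ 0 := by linarith
  refine ⟨(l₁ + (M - 1) * l₂ + M * (M - 3) / 2 * l₃) / (M * (M - 1) / 2),
    (l₁ + (M - 1) * (M - 4) / (2 * (M - 2)) * l₂ - M * (M - 3) / (2 * (M - 2)) * l₃) /
      (M * (M - 1) / 2),
    (l₁ - 2 * (M - 1) / (M - 2) * l₂ + M / (M - 2) * l₃) / (M * (M - 1) / 2), ?_, ?_, ?_⟩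
  · unfold lam1; field_simp; ring
  · unfold lam2; field_simp; ring
  · unfold lam3; field_simp; ring

/-- If the three eigenvalues `λ₁, λ₂, λ₃` of `Δ(M,α,β,γ)` are nonzero, then `Δ(M,α,β,γ)`
is invertible, and its inverse is again of the same form `Δ(M,α',β',γ')`, where the
parameters `α',β',γ'` satisfy `λᵢ(M,α',β',γ') = λᵢ(M,α,β,γ)⁻¹` for `i = 1,2,3`. -/
theorem stmt_12 (M : ℕ) (hM : 3 ≤ M) (α β γ : ℝ)
    (h1 : lam1 M α β γ ≠ 0) (h2 : lam2 M α β γ ≠ 0) (h3 : lam3 M α β γ ≠ 0) :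
    IsUnit (deltaMat M α β γ) ∧
    ∃ α' β' γ' : ℝ, (deltaMat M α β γ)⁻¹ = deltaMat M α' β' γ' ∧
      lam1 M α' β' γ' = (lam1 M α β γ)⁻¹ ∧
      lam2 M α' β' γ' = (lam2 M α β γ)⁻¹ ∧
      lam3 M α' β' γ' = (lam3 M α β γ)⁻¹ := by
  obtain ⟨α', β', γ', e1, e2, e3⟩ :=
    exists_lam_eq hM (lam1 M α β γ)⁻¹ (lam2 M α β γ)⁻¹ (lam3 M α β γ)⁻¹
  have h : deltaMat M α β γ * deltaMat M α' β' γ' = 1 :=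
    deltaMat_mul_eq_one hM (by rw [e1, mul_inv_cancel₀ h1]) (by rw [e2, mul_inv_cancel₀ h2])
      (by rw [e3, mul_inv_cancel₀ h3])
  exact ⟨IsUnit.of_mul_eq_one _ h, α', β', γ', Matrix.inv_eq_right_inv h, e1, e2, e3⟩
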